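/- arXiv:1701.05909 — 2 statements merged into one kernel-verified Lean document; each statement's English description precedes it below -/
import Mathlib

section
/- For every crossing-free matching M of P and every point p of P that is isolated in M, the weighted sum Σ_{i=0}^{4} (4−i)·h_i(p,M) is at most 24. -/
open scoped Classical

noncomputable section

/-- A point of the plane. -/
abbrev Pt : Type := ℝ × ℝ

/-- The closed straight-line segment with endpoints `a` and `b`. -/
def Seg (a b : Pt) : Set Pt := segment ℝ a b

/-- `P` is in general position: no three points of `P` are collinear and
no two points of `P` have the same `x`-coordinate. -/
def GenPos (P : Finset Pt) : Prop :=
  (∀ p ∈ P, ∀ q ∈ P, ∀ r ∈ P, p ≠ q → q ≠ r → p ≠ r →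
      ¬ Collinear ℝ ({p, q, r} : Set Pt)) ∧
  ∀ p ∈ P, ∀ q ∈ P, p ≠ q → p.1 ≠ q.1

/-- `M` is a crossing-free matching of `P`.  Each edge is recorded as an ordered
pair `(left endpoint, right endpoint)`, the left endpoint being the one of
smaller `x`-coordinate.  No point is an endpoint of more than one edge and no
two distinct edges intersect. -/
structure IsMatching (P : Finset Pt) (M : Finset (Pt × Pt)) : Prop where
  left_mem : ∀ e ∈ M, e.1 ∈ P
  right_mem : ∀ e ∈ M, e.2 ∈ P
  x_lt : ∀ e ∈ M, e.1.1 < e.2.1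
  no_shared : ∀ e ∈ M, ∀ f ∈ M, e ≠ f →
      e.1 ≠ f.1 ∧ e.1 ≠ f.2 ∧ e.2 ≠ f.1 ∧ e.2 ≠ f.2
  no_cross : ∀ e ∈ M, ∀ f ∈ M, e ≠ f → Seg e.1 e.2 ∩ Seg f.1 f.2 = ∅

/-- `p` is isolated in `M`: it is an endpoint of no edge of `M`. -/
def Isolated (M : Finset (Pt × Pt)) (p : Pt) : Prop :=
  ∀ e ∈ M, e.1 ≠ p ∧ e.2 ≠ p

/-- The `y`-coordinate of the point of the line through the endpoints of `e`
having abscissa `x`. -/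
def yOn (e : Pt × Pt) (x : ℝ) : ℝ :=
  e.1.2 + (x - e.1.1) * (e.2.2 - e.1.2) / (e.2.1 - e.1.1)

/-- The point of (the line supporting) the edge `e` with the same
`x`-coordinate as `q`. -/
def vproj (e : Pt × Pt) (q : Pt) : Pt := (q.1, yOn e q.1)

/-- `q` is vertically visible from the interior of the edge `e` of `M`:
its `x`-coordinate lies strictly between the `x`-coordinates of the endpoints
of `e`, and the open vertical segment joining `q` to the point of `e` with the
same `x`-coordinate meets no edge of `M` and contains no point of `P`. -/
def VertVisible (P : Finset Pt) (M : Finset (Pt × Pt)) (q : Pt) (e : Pt × Pt) : Prop :=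
  e.1.1 < q.1 ∧ q.1 < e.2.1 ∧
  (∀ f ∈ M, openSegment ℝ q (vproj e q) ∩ Seg f.1 f.2 = ∅) ∧
  ∀ r ∈ P, r ∉ openSegment ℝ q (vproj e q)

/-- `p` is the left endpoint of some edge of `M`. -/
def IsLeftEndpoint (M : Finset (Pt × Pt)) (p : Pt) : Prop := ∃ e ∈ M, e.1 = p

/-- `p` is the right endpoint of some edge of `M`. -/
def IsRightEndpoint (M : Finset (Pt × Pt)) (p : Pt) : Prop := ∃ e ∈ M, e.2 = p

/-- The rank `d_M(p)` of `p` in `M`. -/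
def rank (P : Finset Pt) (M : Finset (Pt × Pt)) (p : Pt) : ℕ :=
  if h : ∃ e ∈ M, e.1 = p then
    (P.filter fun q =>
      (Isolated M q ∨ IsLeftEndpoint M q) ∧ VertVisible P M q h.choose).card
  else if h' : ∃ e ∈ M, e.2 = p then
    (P.filter fun q =>
      (Isolated M q ∨ IsRightEndpoint M q) ∧ VertVisible P M q h'.choose).card
  else 0

/-- The result of inserting the edge `qp` into `M` (oriented left-to-right). -/
def addEdge (M : Finset (Pt × Pt)) (q p : Pt) : Finset (Pt × Pt) :=
  if q.1 < p.1 then insert (q, p) M else insert (p, q) M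

/-- `h_i(p,M)`: the number of points `q ∈ P` such that `M ∪ {qp}` is a
crossing-free matching of `P` in which `p` has rank `i`. -/
def hcount (P : Finset Pt) (M : Finset (Pt × Pt)) (p : Pt) (i : ℕ) : ℕ :=
  (P.filter fun q =>
    IsMatching P (addEdge M q p) ∧ rank P (addEdge M q p) p = i).card

/-- `l_i(p,M)`: the number of points `q ∈ P` to the left of `p` such that
`M ∪ {qp}` is a crossing-free matching of `P` in which `p` has rank `i`. -/
def lcount (P : Finset Pt) (M : Finset (Pt × Pt)) (p : Pt) (i : ℕ) : ℕ :=
  (P.filter fun q => q.1 < p.1 ∧ IsMatching P (insert (q, p) M) ∧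
    rank P (insert (q, p) M) p = i).card

/-- `v_i(M)`: the number of points of `P` of rank `i` in `M`. -/
def vcount (P : Finset Pt) (M : Finset (Pt × Pt)) (i : ℕ) : ℕ :=
  (P.filter fun p => rank P M p = i).card

/-- The (finite) collection of crossing-free matchings of `P` with `m` edges. -/
def Matchings (P : Finset Pt) (m : ℕ) : Finset (Finset (Pt × Pt)) :=
  (P ×ˢ P).powerset.filter fun M => IsMatching P M ∧ M.card = m

/-- `Ma_m(P)`: the number of crossing-free matchings of `P` with `m` edges. -/
def Ma (P : Finset Pt) (m : ℕ) : ℕ := (Matchings P m).card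

/-- `S_k(m)`: the sum of `Σ_{i=0}^{k} (k-i) h_i(p,M')` over all pairs `(p, M')`
with `M'` a crossing-free matching of `P` with `m-1` edges and `p ∈ P`
isolated in `M'`. -/
def Ssum (P : Finset Pt) (k m : ℕ) : ℕ :=
  ∑ M ∈ Matchings P (m - 1), ∑ p ∈ P.filter (fun p => Isolated M p),
    ∑ i ∈ Finset.range (k + 1), (k - i) * hcount P M p i

/-- The union of the edges of `M`, as a subset of the plane. -/
def edgesSet (M : Finset (Pt × Pt)) : Set Pt := ⋃ e ∈ M, Seg e.1 e.2

/-- The vertical wall of `r`: the maximal open vertical segment through `r`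
meeting no edge of `M` except possibly at `r` itself. -/
def Wall (M : Finset (Pt × Pt)) (r : Pt) : Set Pt :=
  {x : Pt | x.1 = r.1 ∧
    ∀ z : Pt, z.1 = r.1 → z.2 ∈ Set.uIcc x.2 r.2 → z ≠ r → z ∉ edgesSet M}

/-- The complement of the union of all edges of `M` and all vertical walls of
points of `P`; its connected components are the cells of the vertical
decomposition. -/
def FreeRegion (P : Finset Pt) (M : Finset (Pt × Pt)) : Set Pt :=
  (edgesSet M ∪ ⋃ r ∈ P, Wall M r)ᶜ

/-- `T` is a cell of the vertical decomposition of `M`. -/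
def IsCell (P : Finset Pt) (M : Finset (Pt × Pt)) (T : Set Pt) : Prop :=
  ∃ x ∈ FreeRegion P M, T = connectedComponentIn (FreeRegion P M) x

/-- `T` is the cell containing the points `(x(p) - ε, y(p))` for all
sufficiently small `ε > 0`. -/
def IsLeftCellOf (P : Finset Pt) (M : Finset (Pt × Pt)) (p : Pt) (T : Set Pt) : Prop :=
  IsCell P M T ∧ ∃ ε₀ > (0 : ℝ), ∀ ε : ℝ, 0 < ε → ε < ε₀ →
    ((p.1 - ε, p.2) : Pt) ∈ T

/-- `T` is the cell containing the points `(x(p) + ε, y(p))` for all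
sufficiently small `ε > 0`. -/
def IsRightCellOf (P : Finset Pt) (M : Finset (Pt × Pt)) (p : Pt) (T : Set Pt) : Prop :=
  IsCell P M T ∧ ∃ ε₀ > (0 : ℝ), ∀ ε : ℝ, 0 < ε → ε < ε₀ →
    ((p.1 + ε, p.2) : Pt) ∈ T

/-- `q` is the left bifurcation point of `p`: part of the boundary of the cell
to the left of `p` lies on the vertical wall of `q`, and `x(q)` is the infimum
of the abscissas of points of that cell. -/
def IsLeftBifPoint (P : Finset Pt) (M : Finset (Pt × Pt)) (p q : Pt) : Prop :=
  q ∈ P ∧ ∃ T, IsLeftCellOf P M p T ∧ (frontier T ∩ Wall M q).Nonempty ∧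
    IsGLB {x : ℝ | ∃ y : ℝ, ((x, y) : Pt) ∈ T} q.1

/-- `q` is the right bifurcation point of `p`. -/
def IsRightBifPoint (P : Finset Pt) (M : Finset (Pt × Pt)) (p q : Pt) : Prop :=
  q ∈ P ∧ ∃ T, IsRightCellOf P M p T ∧ (frontier T ∩ Wall M q).Nonempty ∧
    IsLUB {x : ℝ | ∃ y : ℝ, ((x, y) : Pt) ∈ T} q.1

/-- The edge `e` of `M` is vertically visible below `p`. -/
def EdgeVisBelow (P : Finset Pt) (M : Finset (Pt × Pt)) (e : Pt × Pt) (p : Pt) : Prop :=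
  e.1.1 < p.1 ∧ p.1 < e.2.1 ∧ yOn e p.1 < p.2 ∧
  (∀ f ∈ M, openSegment ℝ p (vproj e p) ∩ Seg f.1 f.2 = ∅) ∧
  ∀ r ∈ P, r ∉ openSegment ℝ p (vproj e p)

/-- The edge `e` of `M` is vertically visible above `p`. -/
def EdgeVisAbove (P : Finset Pt) (M : Finset (Pt × Pt)) (e : Pt × Pt) (p : Pt) : Prop :=
  e.1.1 < p.1 ∧ p.1 < e.2.1 ∧ p.2 < yOn e p.1 ∧
  (∀ f ∈ M, openSegment ℝ p (vproj e p) ∩ Seg f.1 f.2 = ∅) ∧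
  ∀ r ∈ P, r ∉ openSegment ℝ p (vproj e p)

end

/-- The recursive bound. -/
def coreBound : ℕ → ℕ
  | 0 => 0
  | k + 1 => max (k + 1 + coreBound k) (2 * coreBound k)

lemma sign_const {f g : ℝ → ℝ} (hf : Continuous f) (hg : Continuous g) {a b x y : ℝ}
    (h : ∀ z, a ≤ z → z ≤ b → f z ≠ g z) (hx : a ≤ x) (hx' : x ≤ b) (hy : a ≤ y) (hy' : y ≤ b)
    (hlt : f x < g x) : f y < g y := by
  by_contra hcon
  push Not at hcon
  obtain ⟨z, hz, hz0⟩ := (isPreconnected_Icc (a := a) (b := b)).intermediate_value₂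
    (a := x) (b := y) ⟨hx, hx'⟩ ⟨hy, hy'⟩ hf.continuousOn hg.continuousOn hlt.le hcon
  exact h z hz.1 hz.2 hz0

/-- Abstract data: points with coordinates, edges as graphs of functions, candidates. -/
structure Setup where
  P : Finset Pt
  E : Finset (Pt × Pt)
  C : Finset Pt
  X : Pt → ℝ
  Y : Pt → ℝ
  right : Pt × Pt → Pt
  lo : Pt × Pt → ℝ
  G : Pt × Pt → ℝ → ℝ
  L : Pt → ℝ → ℝ
  p0 : ℝ
  good : Pt → Prop
  Xinj : ∀ a ∈ P, ∀ b ∈ P, X a = X b → a = b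
  right_mem : ∀ e ∈ E, right e ∈ P
  right_good : ∀ e ∈ E, good (right e)
  lo_le : ∀ e ∈ E, lo e ≤ X (right e)
  G_right : ∀ e ∈ E, G e (X (right e)) = Y (right e)
  C_sub : ∀ c ∈ C, c ∈ P
  C_lt : ∀ c ∈ C, X c < p0
  C_iso : ∀ c ∈ C, ∀ e ∈ E, right e ≠ c
  C_good : ∀ c ∈ C, good c
  L_self : ∀ c ∈ C, L c (X c) = Y c
  apex : ∀ c ∈ C, ∀ c' ∈ C, L c p0 = L c' p0
  G_cont : ∀ e ∈ E, Continuous (G e)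
  L_cont : ∀ c ∈ C, Continuous (L c)
  disj : ∀ c ∈ C, ∀ e ∈ E, ∀ x, lo e ≤ x → x ≤ X (right e) → X c ≤ x → x ≤ p0 → G e x ≠ L c x

namespace Setup

variable (S : Setup)

/-- Vertical visibility. -/
def Vis (s c : Pt) : Prop :=
  S.X c < S.X s ∧ S.X s < S.p0 ∧ ∀ e ∈ S.E, S.lo e ≤ S.X s → S.X s ≤ S.X (S.right e) →
    ¬ (S.Y s < S.G e (S.X s) ∧ S.G e (S.X s) < S.L c (S.X s)) ∧
    ¬ (S.L c (S.X s) < S.G e (S.X s) ∧ S.G e (S.X s) < S.Y s)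

noncomputable def R (c : Pt) : Finset Pt := S.P.filter fun s => S.good s ∧ S.Vis s c

/-- In the wedge between two candidate segments. -/
def W (c c' u : Pt) : Prop :=
  S.X c < S.X u ∧ S.X c' < S.X u ∧ S.X u < S.p0 ∧
    S.L c (S.X u) < S.Y u ∧ S.Y u < S.L c' (S.X u)

lemma sign_lt {c : Pt} (hc : c ∈ S.C) {e : Pt × Pt} (he : e ∈ S.E) {x y : ℝ}
    (h1 : S.lo e ≤ x) (h2 : x ≤ S.X (S.right e)) (h3 : S.X c ≤ x) (h4 : x ≤ S.p0)
    (k1 : S.lo e ≤ y) (k2 : y ≤ S.X (S.right e)) (k3 : S.X c ≤ y) (k4 : y ≤ S.p0)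
    (h : S.G e x < S.L c x) : S.G e y < S.L c y :=
  sign_const (S.G_cont e he) (S.L_cont c hc)
    (a := max (S.lo e) (S.X c)) (b := min (S.X (S.right e)) S.p0)
    (fun z hz hz' => S.disj c hc e he z ((le_max_left _ _).trans hz) (hz'.trans (min_le_left _ _))
      ((le_max_right _ _).trans hz) (hz'.trans (min_le_right _ _)))
    (max_le h1 h3) (le_min h2 h4) (max_le k1 k3) (le_min k2 k4) h

lemma sign_gt {c : Pt} (hc : c ∈ S.C) {e : Pt × Pt} (he : e ∈ S.E) {x y : ℝ}
    (h1 : S.lo e ≤ x) (h2 : x ≤ S.X (S.right e)) (h3 : S.X c ≤ x) (h4 : x ≤ S.p0)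
    (k1 : S.lo e ≤ y) (k2 : y ≤ S.X (S.right e)) (k3 : S.X c ≤ y) (k4 : y ≤ S.p0)
    (h : S.L c x < S.G e x) : S.L c y < S.G e y :=
  sign_const (S.L_cont c hc) (S.G_cont e he)
    (a := max (S.lo e) (S.X c)) (b := min (S.X (S.right e)) S.p0)
    (fun z hz hz' => (S.disj c hc e he z ((le_max_left _ _).trans hz)
      (hz'.trans (min_le_left _ _))
      ((le_max_right _ _).trans hz) (hz'.trans (min_le_right _ _))).symm)
    (max_le h1 h3) (le_min h2 h4) (max_le k1 k3) (le_min k2 k4) h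

lemma edge_right {c c' : Pt} (hc : c ∈ S.C) (hc' : c' ∈ S.C) {e : Pt × Pt} (he : e ∈ S.E) {x : ℝ}
    (h1 : S.lo e ≤ x) (h2 : x ≤ S.X (S.right e)) (h3 : S.X c ≤ x) (h3' : S.X c' ≤ x)
    (h4 : x < S.p0) (g1 : S.L c x < S.G e x) (g2 : S.G e x < S.L c' x) :
    S.W c c' (S.right e) := by
  have hlt : S.X (S.right e) < S.p0 := by
    by_contra hcon
    push Not at hcon
    have a1 := S.sign_gt hc he h1 h2 h3 h4.le (h1.trans h4.le) hcon (h3.trans h4.le) le_rfl g1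
    have a2 := S.sign_lt hc' he h1 h2 h3' h4.le (h1.trans h4.le) hcon (h3'.trans h4.le) le_rfl g2
    have := S.apex c hc c' hc'
    linarith
  have hc1 : S.X c < S.X (S.right e) := lt_of_le_of_ne (h3.trans h2) fun h =>
    S.C_iso c hc e he (S.Xinj _ (S.right_mem e he) _ (S.C_sub c hc) h.symm)
  have hc2 : S.X c' < S.X (S.right e) := lt_of_le_of_ne (h3'.trans h2) fun h =>
    S.C_iso c' hc' e he (S.Xinj _ (S.right_mem e he) _ (S.C_sub c' hc') h.symm)
  refine ⟨hc1, hc2, hlt, ?_, ?_⟩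
  · rw [← S.G_right e he]
    exact S.sign_gt hc he h1 h2 h3 h4.le (S.lo_le e he) le_rfl (by linarith) hlt.le g1
  · rw [← S.G_right e he]
    exact S.sign_lt hc' he h1 h2 h3' h4.le (S.lo_le e he) le_rfl (by linarith) hlt.le g2

/-- A wedge point which is rightmost among right endpoints in the wedge is visible. -/
lemma wedge_vis {c c' : Pt} (hc : c ∈ S.C) (hc' : c' ∈ S.C) {u : Pt × Pt} (hu : u ∈ S.E)
    (hW : S.W c c' (S.right u))
    (hmax : ∀ e ∈ S.E, S.W c c' (S.right e) → S.X (S.right e) ≤ S.X (S.right u)) :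
    S.right u ∈ S.R c ∧ S.right u ∈ S.R c' := by
  obtain ⟨w1, w2, w3, w4, w5⟩ := hW
  have key : ∀ e ∈ S.E, S.lo e ≤ S.X (S.right u) → S.X (S.right u) ≤ S.X (S.right e) →
      S.L c (S.X (S.right u)) < S.G e (S.X (S.right u)) →
      S.G e (S.X (S.right u)) < S.L c' (S.X (S.right u)) →
      S.G e (S.X (S.right u)) = S.Y (S.right u) := by
    intro e he a1 a2 a3 a4
    have hw := S.edge_right hc hc' he a1 a2 w1.le w2.le w3 a3 a4
    have := S.Xinj _ (S.right_mem e he) _ (S.right_mem u hu) (le_antisymm (hmax e he hw) a2)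
    rw [← this, S.G_right e he]
  unfold R
  simp only [Finset.mem_filter]
  refine ⟨⟨S.right_mem u hu, S.right_good u hu, w1, w3, ?_⟩,
    ⟨S.right_mem u hu, S.right_good u hu, w2, w3, ?_⟩⟩
  · intro e he a1 a2
    refine ⟨fun h => by linarith [h.1, h.2], fun h => ?_⟩
    have := key e he a1 a2 h.1 (by linarith [h.1, h.2])
    linarith [h.1, h.2]
  · intro e he a1 a2
    refine ⟨fun h => ?_, fun h => by linarith [h.1, h.2]⟩
    have := key e he a1 a2 (by linarith [h.1, h.2]) h.2
    linarith [h.1, h.2]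

/-- If no right endpoint lies in the wedge right of `t`, then any right endpoint in the wedge
forces a common element of `R c`, `R c'`, at least as far right, left of `t`. -/
lemma exists_vis {c c' : Pt} (hc : c ∈ S.C) (hc' : c' ∈ S.C) {u : Pt × Pt} (hu : u ∈ S.E)
    (hW : S.W c c' (S.right u)) :
    ∃ v ∈ S.E, S.W c c' (S.right v) ∧ S.right v ∈ S.R c ∧ S.right v ∈ S.R c' ∧
      S.X (S.right u) ≤ S.X (S.right v) := by
  obtain ⟨v, hv, hvm⟩ := (S.E.filter fun e => S.W c c' (S.right e)).exists_max_image
    (fun e => S.X (S.right e)) ⟨u, by simp [hu, hW]⟩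
  simp only [Finset.mem_filter] at hv hvm
  obtain ⟨a, b⟩ := S.wedge_vis hc hc' hv.1 hv.2 (fun e he h => hvm e ⟨he, h⟩)
  exact ⟨v, hv.1, hv.2, a, b, hvm u ⟨hu, hW⟩⟩

lemma sum_aux {D : Finset Pt} {k : ℕ} {s : Pt} {t : ℝ} (hst : S.X s < t)
    (h : ∀ c ∈ D, s ∈ S.R c) (hmax : ∀ c ∈ D, ∀ r ∈ S.R c, S.X r < t → S.X r ≤ S.X s) :
    ∑ c ∈ D, (k + 1 - ((S.R c).filter fun r => S.X r < t).card) =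
    ∑ c ∈ D, (k - ((S.R c).filter fun r => S.X r < S.X s).card) := by
  refine Finset.sum_congr rfl fun c hc => ?_
  have : ((S.R c).filter fun r => S.X r < t) =
      insert s ((S.R c).filter fun r => S.X r < S.X s) := by
    ext r
    simp only [Finset.mem_filter, Finset.mem_insert]
    constructor
    · rintro ⟨h1, h2⟩
      rcases (hmax c hc r h1 h2).eq_or_lt with h3 | h3
      · left
        exact S.Xinj _ (Finset.mem_filter.1 h1).1 _ (Finset.mem_filter.1 (h c hc)).1 h3
      · right; exact ⟨h1, h3⟩
    · rintro (rfl | ⟨h1, h2⟩)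
      · exact ⟨h c hc, hst⟩
      · exact ⟨h1, h2.trans hst⟩
  rw [this, Finset.card_insert_of_notMem (by simp)]
  omega

theorem core (k : ℕ) : ∀ (D : Finset Pt) (t : ℝ), D ⊆ S.C → t ≤ S.p0 → (∀ c ∈ D, S.X c < t) →
    (∀ c ∈ D, ∀ c' ∈ D, ∀ e ∈ S.E, t ≤ S.X (S.right e) → ¬ S.W c c' (S.right e)) →
    ∑ c ∈ D, (k - ((S.R c).filter fun r => S.X r < t).card) ≤ coreBound k := by
  induction k with
  | zero => intro D t _ _ _ _; simp
  | succ k ih =>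
    intro D t hD ht hDt hW
    rcases D.eq_empty_or_nonempty with rfl | hne
    · simp
    -- the first event
    obtain ⟨s, hs, hsmax⟩ := (D.biUnion fun c => insert c ((S.R c).filter fun r => S.X r < t)
      ).exists_max_image S.X (by
        obtain ⟨c, hc⟩ := hne
        exact ⟨c, by simp only [Finset.mem_biUnion]; exact ⟨c, hc, by simp⟩⟩)
    have hmaxc : ∀ c ∈ D, S.X c ≤ S.X s := fun c hc =>
      hsmax c (by simp only [Finset.mem_biUnion]; exact ⟨c, hc, by simp⟩)
    have hmaxR : ∀ c ∈ D, ∀ r ∈ S.R c, S.X r < t → S.X r ≤ S.X s := fun c hc r hr hrt =>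
      hsmax r (by simp only [Finset.mem_biUnion]; exact ⟨c, hc, by simp [hr, hrt]⟩)
    simp only [Finset.mem_biUnion, Finset.mem_insert, Finset.mem_filter] at hs
    obtain ⟨c0, hc0, hs⟩ := hs
    have hsP : s ∈ S.P := by
      rcases hs with rfl | h
      · exact S.C_sub _ (hD hc0)
      · exact (Finset.mem_filter.1 h.1).1
    have hst : S.X s < t := by
      rcases hs with rfl | h
      · exact hDt _ hc0
      · exact h.2
    have hsp : S.X s < S.p0 := hst.trans_le ht
    have hW' : ∀ c ∈ D, ∀ c' ∈ D, ∀ e ∈ S.E, S.X s < S.X (S.right e) →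
        ¬ S.W c c' (S.right e) := by
      intro c hc c' hc' e he hlt hw
      obtain ⟨v, hv, hvW, hvR, -, hle⟩ := S.exists_vis (hD hc) (hD hc') he hw
      by_cases hvt : t ≤ S.X (S.right v)
      · exact hW c hc c' hc' v hv hvt hvW
      · have := hmaxR c hc _ hvR (not_le.1 hvt)
        linarith
    have hcs : ∀ c ∈ D, c ≠ s → S.X c < S.X s := fun c hc hne =>
      lt_of_le_of_ne (hmaxc c hc) fun h => hne (S.Xinj _ (S.C_sub _ (hD hc)) _ hsP h)
    have hblock : ∀ c ∈ D, ∀ c' ∈ D, ∀ e ∈ S.E, S.lo e ≤ S.X s →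
        S.X s ≤ S.X (S.right e) → S.L c (S.X s) < S.G e (S.X s) →
        S.G e (S.X s) < S.L c' (S.X s) → S.G e (S.X s) = S.Y s := by
      intro c hc c' hc' e he a1 a2 a3 a4
      have hw := S.edge_right (hD hc) (hD hc') he a1 a2 (hmaxc c hc) (hmaxc c' hc') hsp a3 a4
      rcases a2.eq_or_lt with h | h
      · have := S.Xinj _ hsP _ (S.right_mem e he) h
        rw [this, S.G_right e he]
      · exact absurd hw (hW' c hc c' hc' e he h)
    have hgood : S.good s := by
      rcases hs with rfl | h
      · exact S.C_good _ (hD hc0)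
      · exact (Finset.mem_filter.1 h.1).2.1
    have hfree : ∀ e ∈ S.E, S.lo e ≤ S.X s → S.X s ≤ S.X (S.right e) →
        ¬ (S.Y s < S.G e (S.X s) ∧ S.G e (S.X s) < S.L c0 (S.X s)) ∧
        ¬ (S.L c0 (S.X s) < S.G e (S.X s) ∧ S.G e (S.X s) < S.Y s) := by
      rcases hs with rfl | h
      · intro e he _ _
        rw [S.L_self _ (hD hc0)]
        exact ⟨fun h => lt_asymm h.1 h.2, fun h => lt_asymm h.1 h.2⟩
      · exact (Finset.mem_filter.1 h.1).2.2.2.2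
    have hsR : ∀ c ∈ D, c ≠ s → s ∈ S.R c := by
      intro c hc hne
      refine Finset.mem_filter.2 ⟨hsP, hgood, hcs c hc hne, hsp, fun e he a1 a2 => ?_⟩
      obtain ⟨f1, f2⟩ := hfree e he a1 a2
      have hne0 := S.disj c0 (hD hc0) e he _ a1 a2 (hmaxc c0 hc0) hsp.le
      have b1 := hblock c hc c0 hc0 e he a1 a2
      have b2 := hblock c0 hc0 c hc e he a1 a2
      constructor
      · rintro ⟨g1, g2⟩
        rcases lt_or_gt_of_ne hne0 with h | h
        · exact f1 ⟨g1, h⟩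
        · exact g1.ne' (b2 h g2)
      · rintro ⟨g1, g2⟩
        rcases lt_or_gt_of_ne hne0 with h | h
        · exact g2.ne (b1 g1 h)
        · exact f2 ⟨h, g2⟩
    by_cases hright : ∃ e ∈ S.E, S.right e = s
    · obtain ⟨e, he, hes⟩ := hright
      have hns : ∀ c ∈ D, c ≠ s := fun c hc h => S.C_iso c (hD hc) e he (hes.trans h.symm)
      have hYne : ∀ c ∈ D, S.Y s ≠ S.L c (S.X s) := by
        intro c hc
        have := S.disj c (hD hc) e he (S.X s) (hes ▸ S.lo_le e he) (by rw [hes])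
          (hmaxc c hc) hsp.le
        rwa [← hes, S.G_right e he, hes] at this
      rw [S.sum_aux hst (fun c hc => hsR c hc (hns c hc)) hmaxR,
        ← Finset.sum_filter_add_sum_filter_not D (fun c => S.Y s < S.L c (S.X s))]
      have i1 := ih (D.filter fun c => S.Y s < S.L c (S.X s)) (S.X s)
        ((Finset.filter_subset _ _).trans hD) hsp.le
        (fun c hc => hcs c (Finset.mem_filter.1 hc).1 (hns c (Finset.mem_filter.1 hc).1)) (by
          intro c hc c' hc' f hf hle hw
          rw [Finset.mem_filter] at hc hc'
          rcases hle.eq_or_lt with h | h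
          · have hfs := S.Xinj _ hsP _ (S.right_mem f hf) h
            rw [← hfs] at hw
            exact lt_asymm hw.2.2.2.1 hc.2
          · exact hW' c hc.1 c' hc'.1 f hf h hw)
      have i2 := ih (D.filter fun c => ¬ S.Y s < S.L c (S.X s)) (S.X s)
        ((Finset.filter_subset _ _).trans hD) hsp.le
        (fun c hc => hcs c (Finset.mem_filter.1 hc).1 (hns c (Finset.mem_filter.1 hc).1)) (by
          intro c hc c' hc' f hf hle hw
          rw [Finset.mem_filter] at hc hc'
          rcases hle.eq_or_lt with h | h
          · have hfs := S.Xinj _ hsP _ (S.right_mem f hf) h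
            rw [← hfs] at hw
            exact hc'.2 hw.2.2.2.2
          · exact hW' c hc.1 c' hc'.1 f hf h hw)
      refine le_trans (add_le_add i1 i2) ?_
      rw [coreBound]
      refine le_trans (by omega) (le_max_right _ _)
    · have i1 := ih (D.erase s) (S.X s)
        ((Finset.erase_subset _ _).trans hD) hsp.le
        (fun c hc => hcs c (Finset.mem_erase.1 hc).2 (Finset.mem_erase.1 hc).1) (by
          intro c hc c' hc' f hf hle hw
          rw [Finset.mem_erase] at hc hc'
          rcases hle.eq_or_lt with h | h
          · exact hright ⟨f, hf, (S.Xinj _ hsP _ (S.right_mem f hf) h).symm⟩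
          · exact hW' c hc.2 c' hc'.2 f hf h hw)
      rw [← S.sum_aux hst (fun c hc => hsR c (Finset.mem_erase.1 hc).2 (Finset.mem_erase.1 hc).1)
        (fun c hc => hmaxR c (Finset.mem_erase.1 hc).2)] at i1
      rw [coreBound]
      refine le_trans ?_ (le_max_left _ _)
      by_cases hsD : s ∈ D
      · rw [← Finset.add_sum_erase D _ hsD]
        exact add_le_add (Nat.sub_le _ _) i1
      · rw [Finset.erase_eq_of_notMem hsD] at i1
        omega

theorem main_bound : ∑ c ∈ S.C, (4 - (S.R c).card) ≤ 12 := by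
  have h := S.core 4 S.C S.p0 subset_rfl le_rfl S.C_lt
    (fun c _ c' _ e _ h hw => absurd hw.2.2.1 (not_lt.2 h))
  have h12 : coreBound 4 = 12 := by simp [coreBound]
  rw [h12] at h
  convert h using 4 with c hc
  symm
  rw [Finset.filter_eq_self]
  intro r hr
  exact (Finset.mem_filter.1 hr).2.2.2.1

end Setup

lemma yOn_mem_seg {e : Pt × Pt} (he : e.1.1 < e.2.1) {x : ℝ} (h1 : e.1.1 ≤ x) (h2 : x ≤ e.2.1) :
    ((x, yOn e x) : Pt) ∈ Seg e.1 e.2 := by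
  have hd : 0 < e.2.1 - e.1.1 := by linarith
  refine ⟨(e.2.1 - x) / (e.2.1 - e.1.1), (x - e.1.1) / (e.2.1 - e.1.1),
    div_nonneg (by linarith) hd.le, div_nonneg (by linarith) hd.le, ?_, ?_⟩
  · rw [← add_div, div_eq_one_iff_eq hd.ne']; ring
  · ext
    · simp only [Prod.fst_add, Prod.smul_fst, smul_eq_mul]
      field_simp; ring
    · simp only [Prod.snd_add, Prod.smul_snd, smul_eq_mul, yOn]
      field_simp; ring

lemma seg_yOn {e : Pt × Pt} (he : e.1.1 < e.2.1) {z : Pt} (hz : z ∈ Seg e.1 e.2) :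
    e.1.1 ≤ z.1 ∧ z.1 ≤ e.2.1 ∧ z.2 = yOn e z.1 := by
  have hd : e.2.1 - e.1.1 ≠ 0 := by linarith
  obtain ⟨a, b, ha, hb, hab, rfl⟩ := hz
  obtain rfl : a = 1 - b := by linarith
  simp only [Prod.fst_add, Prod.smul_fst, Prod.snd_add, Prod.smul_snd, smul_eq_mul, yOn]
  refine ⟨by nlinarith, by nlinarith, ?_⟩
  field_simp; ring

lemma openSeg_vert {q z : Pt} {e : Pt × Pt} (hz : z ∈ openSegment ℝ q (vproj e q)) :
    z.1 = q.1 ∧ (q.2 < yOn e q.1 → q.2 < z.2 ∧ z.2 < yOn e q.1) ∧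
      (yOn e q.1 < q.2 → yOn e q.1 < z.2 ∧ z.2 < q.2) := by
  obtain ⟨a, b, ha, hb, hab, rfl⟩ := hz
  obtain rfl : a = 1 - b := by linarith
  simp only [Prod.fst_add, Prod.smul_fst, Prod.snd_add, Prod.smul_snd, smul_eq_mul, vproj]
  refine ⟨by ring, fun h => ⟨by nlinarith, by nlinarith⟩, fun h => ⟨by nlinarith, by nlinarith⟩⟩

lemma collinear_yOn {e : Pt × Pt} (he : e.1.1 < e.2.1) {r : Pt} (h : r.2 = yOn e r.1) :
    Collinear ℝ ({e.1, r, e.2} : Set Pt) := by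
  have hd : e.2.1 - e.1.1 ≠ 0 := by linarith
  rw [collinear_iff_of_mem (p₀ := e.1) (by simp)]
  refine ⟨e.2 - e.1, ?_⟩
  intro z hz
  simp only [Set.mem_insert_iff, Set.mem_singleton_iff] at hz
  rcases hz with rfl | rfl | rfl
  · exact ⟨0, by simp⟩
  · refine ⟨(z.1 - e.1.1) / (e.2.1 - e.1.1), ?_⟩
    ext
    · simp; field_simp; ring
    · simp [h, yOn]; field_simp; ring
  · exact ⟨1, by simp⟩

lemma yOn_left (e : Pt × Pt) : yOn e e.1.1 = e.1.2 := by simp [yOn]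

lemma yOn_right {e : Pt × Pt} (he : e.1.1 < e.2.1) : yOn e e.2.1 = e.2.2 := by
  have hd : e.2.1 - e.1.1 ≠ 0 := by linarith
  simp only [yOn]; field_simp; ring

lemma yOn_cont (e : Pt × Pt) : Continuous (yOn e) := by
  unfold yOn; fun_prop

lemma vertVisible_of {P : Finset Pt} (hP : GenPos P) {M : Finset (Pt × Pt)} {e : Pt × Pt}
    (hM' : IsMatching P (insert e M)) {r : Pt} (hr : r ∈ P) (h1 : e.1.1 < r.1) (h2 : r.1 < e.2.1)
    (h : ∀ f ∈ M, f.1.1 ≤ r.1 → r.1 ≤ f.2.1 →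
      ¬ (r.2 < yOn f r.1 ∧ yOn f r.1 < yOn e r.1) ∧
      ¬ (yOn e r.1 < yOn f r.1 ∧ yOn f r.1 < r.2)) :
    VertVisible P (insert e M) r e := by
  have he : e ∈ insert e M := Finset.mem_insert_self _ _
  have hne : r.2 ≠ yOn e r.1 := by
    intro hc
    refine hP.1 _ (hM'.left_mem e he) _ hr _ (hM'.right_mem e he) ?_ ?_ ?_
      (collinear_yOn (h1.trans h2) hc)
    · intro h; rw [h] at h1; exact lt_irrefl _ h1
    · intro h; rw [h] at h2; exact lt_irrefl _ h2
    · intro h; rw [h] at h1; exact lt_asymm h1 h2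
  refine ⟨h1, h2, ?_, ?_⟩
  · intro f hf
    rw [Set.eq_empty_iff_forall_notMem]
    rintro z ⟨hz1, hz2⟩
    obtain ⟨a, b, c⟩ := openSeg_vert hz1
    obtain ⟨k1, k2, k3⟩ := seg_yOn (hM'.x_lt f hf) hz2
    rw [a] at k1 k2 k3
    rw [k3] at b c
    rcases Finset.mem_insert.1 hf with rfl | hf
    · rcases lt_or_gt_of_ne hne with h | h
      · exact lt_irrefl _ (b h).2
      · exact lt_irrefl _ (c h).1
    · obtain ⟨g1, g2⟩ := h f hf k1 k2
      rcases lt_or_gt_of_ne hne with h | h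
      · exact g1 (b h)
      · exact g2 (c h)
  · intro z hz hz1
    obtain ⟨a, b, c⟩ := openSeg_vert hz1
    have hzr : z = r := by
      by_contra hc
      exact hP.2 z hz r hr hc a
    subst hzr
    rcases lt_or_gt_of_ne hne with h | h
    · exact lt_irrefl _ (b h).1
    · exact lt_irrefl _ (c h).2

section

variable {P : Finset Pt} {M : Finset (Pt × Pt)} {p : Pt}

lemma disj_of {e f : Pt × Pt} (hM' : IsMatching P (insert e M)) (hf : f ∈ M) (hne : f ≠ e)
    {x : ℝ} (h1 : f.1.1 ≤ x) (h2 : x ≤ f.2.1) (h3 : e.1.1 ≤ x) (h4 : x ≤ e.2.1) :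
    yOn f x ≠ yOn e x := by
  intro h
  have he : e ∈ insert e M := Finset.mem_insert_self _ _
  have hf' : f ∈ insert e M := Finset.mem_insert_of_mem hf
  have a := yOn_mem_seg (hM'.x_lt f hf') h1 h2
  have b := yOn_mem_seg (hM'.x_lt e he) h3 h4
  rw [h] at a
  have := hM'.no_cross f hf' e he hne
  exact (Set.eq_empty_iff_forall_notMem.1 this) _ ⟨a, b⟩

lemma rank_left {q : Pt} (hiso : Isolated M p) (hlt : q.1 < p.1) :
    rank P (insert (q, p) M) p = (P.filter fun r =>
      (Isolated (insert (q, p) M) r ∨ IsRightEndpoint (insert (q, p) M) r) ∧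
        VertVisible P (insert (q, p) M) r (q, p)).card := by
  have h1 : ¬ ∃ e ∈ insert (q, p) M, e.1 = p := by
    rintro ⟨e, he, h⟩
    rcases Finset.mem_insert.1 he with rfl | he
    · simp only at h; rw [h] at hlt; exact lt_irrefl _ hlt
    · exact (hiso e he).1 h
  have h2 : ∃ e ∈ insert (q, p) M, e.2 = p := ⟨(q, p), Finset.mem_insert_self _ _, rfl⟩
  have h3 : h2.choose = (q, p) := by
    obtain ⟨he, h⟩ := h2.choose_spec
    rcases Finset.mem_insert.1 he with h' | he
    · exact h'
    · exact absurd h (hiso _ he).2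
  unfold rank
  rw [dif_neg h1, dif_pos h2, h3]

lemma rank_right {q : Pt} (hiso : Isolated M p) :
    rank P (insert (p, q) M) p = (P.filter fun r =>
      (Isolated (insert (p, q) M) r ∨ IsLeftEndpoint (insert (p, q) M) r) ∧
        VertVisible P (insert (p, q) M) r (p, q)).card := by
  have h2 : ∃ e ∈ insert (p, q) M, e.1 = p := ⟨(p, q), Finset.mem_insert_self _ _, rfl⟩
  have h3 : h2.choose = (p, q) := by
    obtain ⟨he, h⟩ := h2.choose_spec
    rcases Finset.mem_insert.1 he with h' | he
    · exact h'
    · exact absurd h (hiso _ he).1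
  unfold rank
  rw [dif_pos h2, h3]

/-- Data for edges to the left of `p`. -/
noncomputable def leftSetup (hP : GenPos P) (hM : IsMatching P M) (hiso : Isolated M p) :
    Setup where
  P := P
  E := M
  C := P.filter fun q => q.1 < p.1 ∧ IsMatching P (insert (q, p) M)
  X := fun q => q.1
  Y := fun q => q.2
  right := fun e => e.2
  lo := fun e => e.1.1
  G := yOn
  L := fun q => yOn (q, p)
  p0 := p.1
  good := fun r => Isolated M r ∨ IsRightEndpoint M r
  Xinj := fun a ha b hb h => by by_contra hc; exact hP.2 a ha b hb hc h
  right_mem := hM.right_mem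
  right_good := fun e he => Or.inr ⟨e, he, rfl⟩
  lo_le := fun e he => (hM.x_lt e he).le
  G_right := fun e he => yOn_right (hM.x_lt e he)
  C_sub := fun c hc => (Finset.mem_filter.1 hc).1
  C_lt := fun c hc => (Finset.mem_filter.1 hc).2.1
  C_iso := fun c hc e he h => by
    have hM' := (Finset.mem_filter.1 hc).2.2
    have hne : e ≠ (c, p) := fun h => (hiso e he).2 (by rw [h])
    exact (hM'.no_shared e (Finset.mem_insert_of_mem he) _ (Finset.mem_insert_self _ _) hne).2.2.1 h
  C_good := fun c hc => by
    left
    intro e he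
    have hM' := (Finset.mem_filter.1 hc).2.2
    have hne : e ≠ (c, p) := fun h => (hiso e he).2 (by rw [h])
    have := hM'.no_shared e (Finset.mem_insert_of_mem he) _ (Finset.mem_insert_self _ _) hne
    exact ⟨this.1, this.2.2.1⟩
  L_self := fun c _ => yOn_left (c, p)
  apex := fun c hc c' hc' => by
    have a := yOn_right (e := (c, p)) (Finset.mem_filter.1 hc).2.1
    have b := yOn_right (e := (c', p)) (Finset.mem_filter.1 hc').2.1
    exact a.trans b.symm
  G_cont := fun e _ => yOn_cont e
  L_cont := fun c _ => yOn_cont (c, p)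
  disj := fun c hc e he x h1 h2 h3 h4 => disj_of (Finset.mem_filter.1 hc).2.2 he
    (fun h => (hiso e he).2 (by rw [h])) h1 h2 h3 h4

/-- Data for edges to the right of `p`. -/
noncomputable def rightSetup (hP : GenPos P) (hM : IsMatching P M) (hiso : Isolated M p) :
    Setup where
  P := P
  E := M
  C := P.filter fun q => p.1 < q.1 ∧ IsMatching P (insert (p, q) M)
  X := fun q => - q.1
  Y := fun q => q.2
  right := fun e => e.1
  lo := fun e => - e.2.1
  G := fun e x => yOn e (- x)
  L := fun q x => yOn (p, q) (- x)
  p0 := - p.1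
  good := fun r => Isolated M r ∨ IsLeftEndpoint M r
  Xinj := fun a ha b hb h => by by_contra hc; exact hP.2 a ha b hb hc (neg_injective h)
  right_mem := hM.left_mem
  right_good := fun e he => Or.inr ⟨e, he, rfl⟩
  lo_le := fun e he => neg_le_neg (hM.x_lt e he).le
  G_right := fun e he => by rw [neg_neg]; exact yOn_left e
  C_sub := fun c hc => (Finset.mem_filter.1 hc).1
  C_lt := fun c hc => neg_lt_neg (Finset.mem_filter.1 hc).2.1
  C_iso := fun c hc e he h => by
    have hM' := (Finset.mem_filter.1 hc).2.2
    have hne : e ≠ (p, c) := fun h => (hiso e he).1 (by rw [h])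
    exact (hM'.no_shared e (Finset.mem_insert_of_mem he) _ (Finset.mem_insert_self _ _) hne).2.1 h
  C_good := fun c hc => by
    left
    intro e he
    have hM' := (Finset.mem_filter.1 hc).2.2
    have hne : e ≠ (p, c) := fun h => (hiso e he).1 (by rw [h])
    have := hM'.no_shared e (Finset.mem_insert_of_mem he) _ (Finset.mem_insert_self _ _) hne
    exact ⟨this.2.1, this.2.2.2⟩
  L_self := fun c hc => by
    rw [neg_neg]; exact yOn_right (e := (p, c)) (Finset.mem_filter.1 hc).2.1
  apex := fun c hc c' hc' => by
    rw [neg_neg]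
    exact (yOn_left (p, c)).trans (yOn_left (p, c')).symm
  G_cont := fun e _ => (yOn_cont e).comp continuous_neg
  L_cont := fun c _ => (yOn_cont (p, c)).comp continuous_neg
  disj := fun c hc e he x h1 h2 h3 h4 => disj_of (Finset.mem_filter.1 hc).2.2 he
    (fun h => (hiso e he).1 (by rw [h])) (le_neg.1 h2) (neg_le.1 h1) (le_neg.1 h4) (neg_le.1 h3)

lemma isolated_insert {e : Pt × Pt} {r : Pt} (h : Isolated M r) (h1 : e.1.1 < r.1)
    (h2 : r.1 < e.2.1) : Isolated (insert e M) r := by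
  intro f hf
  rcases Finset.mem_insert.1 hf with rfl | hf
  · exact ⟨fun h => by rw [h] at h1; exact lt_irrefl _ h1,
      fun h => by rw [h] at h2; exact lt_irrefl _ h2⟩
  · exact h f hf

lemma left_bound (hP : GenPos P) (hM : IsMatching P M) (hiso : Isolated M p) :
    ∑ q ∈ P.filter (fun q => q.1 < p.1 ∧ IsMatching P (insert (q, p) M)),
      (4 - rank P (insert (q, p) M) p) ≤ 12 := by
  refine le_trans (Finset.sum_le_sum fun q hq => ?_) (leftSetup hP hM hiso).main_bound
  refine Nat.sub_le_sub_left ?_ 4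
  have hq' := (Finset.mem_filter.1 hq).2
  rw [rank_left hiso hq'.1]
  refine Finset.card_le_card fun r hr => ?_
  obtain ⟨hr, hg, h1, h2, h3⟩ := Finset.mem_filter.1 hr
  refine Finset.mem_filter.2 ⟨hr, ?_, vertVisible_of hP hq'.2 hr h1 h2 h3⟩
  rcases hg with hg | ⟨e, he, h⟩
  · exact Or.inl (isolated_insert hg h1 h2)
  · exact Or.inr ⟨e, Finset.mem_insert_of_mem he, h⟩

lemma right_bound (hP : GenPos P) (hM : IsMatching P M) (hiso : Isolated M p) :
    ∑ q ∈ P.filter (fun q => p.1 < q.1 ∧ IsMatching P (insert (p, q) M)),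
      (4 - rank P (insert (p, q) M) p) ≤ 12 := by
  refine le_trans (Finset.sum_le_sum fun q hq => ?_) (rightSetup hP hM hiso).main_bound
  refine Nat.sub_le_sub_left ?_ 4
  have hq' := (Finset.mem_filter.1 hq).2
  rw [rank_right hiso]
  refine Finset.card_le_card fun r hr => ?_
  obtain ⟨hr, hg, h1, h2, h3⟩ := Finset.mem_filter.1 hr
  have h1' : r.1 < q.1 := neg_lt_neg_iff.1 h1
  have h2' : p.1 < r.1 := neg_lt_neg_iff.1 h2
  refine Finset.mem_filter.2 ⟨hr, ?_, vertVisible_of hP hq'.2 hr h2' h1' ?_⟩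
  · rcases hg with hg | ⟨e, he, h⟩
    · exact Or.inl (isolated_insert hg h2' h1')
    · exact Or.inr ⟨e, Finset.mem_insert_of_mem he, h⟩
  · intro f hf a b
    have := h3 f hf (neg_le_neg b) (neg_le_neg a)
    simpa only [rightSetup, neg_neg] using this

end

theorem weighted_hcount_four_le (P : Finset Pt) (hP : GenPos P)
    (M : Finset (Pt × Pt)) (hM : IsMatching P M)
    (p : Pt) (hp : p ∈ P) (hiso : Isolated M p) :
    ∑ i ∈ Finset.range 5, (4 - i) * hcount P M p i ≤ 24 := by
  have key : ∑ i ∈ Finset.range 5, (4 - i) * hcount P M p i =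
      ∑ q ∈ P.filter (fun q => IsMatching P (addEdge M q p)),
        (4 - rank P (addEdge M q p) p) := by
    have : ∀ i ∈ Finset.range 5, (4 - i) * hcount P M p i =
        ∑ q ∈ P.filter (fun q => IsMatching P (addEdge M q p)),
          if rank P (addEdge M q p) p = i then 4 - i else 0 := by
      intro i _
      rw [← Finset.sum_filter, Finset.filter_filter, Finset.sum_const, smul_eq_mul, mul_comm]
      rfl
    rw [Finset.sum_congr rfl this, Finset.sum_comm]
    refine Finset.sum_congr rfl fun q _ => ?_
    rw [Finset.sum_ite_eq]
    split_ifs with h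
    · rfl
    · rw [Finset.mem_range] at h; omega
  rw [key, ← Finset.sum_filter_add_sum_filter_not _ (fun q : Pt => q.1 < p.1)]
  refine le_trans (add_le_add (le_trans (le_of_eq ?_) (left_bound hP hM hiso))
    (le_trans (le_of_eq ?_) (right_bound hP hM hiso))) (by norm_num)
  · refine Finset.sum_congr ?_ ?_
    · ext q
      simp only [Finset.mem_filter]
      constructor
      · rintro ⟨⟨a, b⟩, c⟩
        rw [addEdge, if_pos c] at b
        exact ⟨a, c, b⟩
      · rintro ⟨a, c, b⟩
        refine ⟨⟨a, ?_⟩, c⟩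
        rwa [addEdge, if_pos c]
    · intro q hq
      rw [addEdge, if_pos (Finset.mem_filter.1 hq).2.1]
  · refine Finset.sum_congr ?_ ?_
    · ext q
      simp only [Finset.mem_filter]
      constructor
      · rintro ⟨⟨a, b⟩, c⟩
        rw [addEdge, if_neg c] at b
        exact ⟨a, b.x_lt _ (Finset.mem_insert_self _ _), b⟩
      · rintro ⟨a, c, b⟩
        refine ⟨⟨a, ?_⟩, not_lt.2 c.le⟩
        rwa [addEdge, if_neg (not_lt.2 c.le)]
    · intro q hq
      rw [addEdge, if_neg (not_lt.2 (Finset.mem_filter.1 hq).2.1.le)]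
end

section
/- For every integer m ≥ 1, writing s = n − 2m, one has S_5(m) ≤ 48·(s + 2)·Ma_{m−1}(P). -/
open scoped Classical

namespace Aux

def G : ℕ → ℕ
  | 0 => 0
  | k + 1 => max (k + 1 + G k) (2 * G k)

def Btw (a b z : ℝ) : Prop := (a < z ∧ z < b) ∨ (b < z ∧ z < a)

lemma yOn_left (q p : Pt) : yOn (q, p) q.1 = q.2 := by simp [yOn]

lemma yOn_right (q p : Pt) (h : q.1 < p.1) : yOn (q, p) p.1 = p.2 := by
  have : p.1 - q.1 ≠ 0 := by linarith
  simp only [yOn]; field_simp; ring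

lemma yOn_cont (e : Pt × Pt) : Continuous (yOn e) := by
  unfold yOn; fun_prop

lemma sign_keep (f g : ℝ → ℝ) (hf : Continuous f) (hg : Continuous g) (a b : ℝ) (hab : a ≤ b)
    (h0 : g a < f a) (hne : ∀ x, a ≤ x → x ≤ b → f x ≠ g x) : g b < f b := by
  by_contra hc
  push Not at hc
  have hc' : Continuous (fun x => f x - g x) := hf.sub hg
  have := intermediate_value_Icc' hab hc'.continuousOn
  have h := this (show (0 : ℝ) ∈ _ from ⟨by linarith, by linarith⟩)
  obtain ⟨x, hx, hx'⟩ := h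
  exact hne x hx.1 hx.2 (by simp only at hx'; linarith)

def NC (M : Finset (Pt × Pt)) (p q : Pt) : Prop :=
  ∀ f ∈ M, ∀ x, q.1 ≤ x → x ≤ p.1 → f.1.1 ≤ x → x ≤ f.2.1 → yOn f x ≠ yOn (q, p) x

lemma key1 {M : Finset (Pt × Pt)} {p q q' : Pt} (hq : q.1 < p.1) (hq' : q'.1 < p.1)
    (hn : NC M p q) (hn' : NC M p q') {f : Pt × Pt} (hf : f ∈ M) (hfx : f.1.1 < f.2.1) {x : ℝ}
    (h1 : q.1 ≤ x) (h1' : q'.1 ≤ x) (h2 : x < p.1) (h3 : f.1.1 ≤ x) (h4 : x ≤ f.2.1)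
    (ha : yOn (q, p) x < yOn f x) (hb : yOn f x < yOn (q', p) x) :
    f.2.1 < p.1 ∧ yOn (q, p) f.2.1 < f.2.2 ∧ f.2.2 < yOn (q', p) f.2.1 := by
  have A : ∀ z, x ≤ z → z ≤ f.2.1 → z ≤ p.1 → yOn (q, p) z < yOn f z ∧ yOn f z < yOn (q', p) z := by
    intro z hz hz1 hz2
    constructor
    · exact sign_keep _ _ (yOn_cont _) (yOn_cont _) x z hz ha
        (fun y hy hy' => hn f hf y (by linarith) (by linarith) (by linarith) (by linarith))
    · exact sign_keep _ _ (yOn_cont _) (yOn_cont _) x z hz hb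
        (fun y hy hy' => (hn' f hf y (by linarith) (by linarith) (by linarith) (by linarith)).symm)
  have hlt : f.2.1 < p.1 := by
    by_contra hc
    push Not at hc
    have := A p.1 h2.le hc le_rfl
    rw [yOn_right _ _ hq, yOn_right _ _ hq'] at this
    linarith
  have := A f.2.1 h4 le_rfl hlt.le
  have e : yOn f f.2.1 = f.2.2 := yOn_right f.1 f.2 hfx
  rw [e] at this
  exact ⟨hlt, this⟩

lemma key {M : Finset (Pt × Pt)} {p q q' : Pt} (hq : q.1 < p.1) (hq' : q'.1 < p.1)
    (hn : NC M p q) (hn' : NC M p q') {f : Pt × Pt} (hf : f ∈ M) (hfx : f.1.1 < f.2.1) {x : ℝ}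
    (h1 : q.1 ≤ x) (h1' : q'.1 ≤ x) (h2 : x < p.1) (h3 : f.1.1 ≤ x) (h4 : x ≤ f.2.1)
    (h : Btw (yOn (q, p) x) (yOn (q', p) x) (yOn f x)) :
    f.2.1 < p.1 ∧ Btw (yOn (q, p) f.2.1) (yOn (q', p) f.2.1) f.2.2 := by
  rcases h with ⟨a, b⟩ | ⟨a, b⟩
  · have := key1 hq hq' hn hn' hf hfx h1 h1' h2 h3 h4 a b
    exact ⟨this.1, Or.inl this.2⟩
  · have := key1 hq' hq hn' hn hf hfx h1' h1 h2 h3 h4 a b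
    exact ⟨this.1, Or.inr this.2⟩

def Vis (M : Finset (Pt × Pt)) (p q r : Pt) : Prop :=
  q.1 < r.1 ∧ r.1 < p.1 ∧ ∀ f ∈ M, f.1.1 ≤ r.1 → r.1 ≤ f.2.1 →
    ¬ Btw r.2 (yOn (q, p) r.1) (yOn f r.1)

noncomputable def R (I : Finset Pt) (M : Finset (Pt × Pt)) (p q : Pt) : Finset Pt :=
  (I ∪ M.image Prod.snd).filter (Vis M p q)

theorem main (p : Pt) (I : Finset Pt) (M : Finset (Pt × Pt))
    (hM : ∀ e ∈ M, e.1.1 < e.2.1) (hinj : ∀ e ∈ M, ∀ f ∈ M, e.2.1 = f.2.1 → e = f)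
    (hIM : ∀ e ∈ M, ∀ r ∈ I, e.2.1 ≠ r.1) (hI : ∀ r ∈ I, ∀ s ∈ I, r.1 = s.1 → r = s) :
    ∀ (k : ℕ) (t : ℝ) (C : Finset Pt), t ≤ p.1 → C ⊆ I → (∀ q ∈ C, q.1 < t) →
      (∀ q ∈ C, NC M p q) →
      (∀ q ∈ C, ∀ q' ∈ C, ∀ f ∈ M, t ≤ f.2.1 → f.2.1 < p.1 →
        ¬ Btw (yOn (q, p) f.2.1) (yOn (q', p) f.2.1) f.2.2) →
      ∑ q ∈ C, (k - ((R I M p q).filter (fun r => r.1 < t)).card) ≤ G k := by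
  intro k
  induction k with
  | zero => intros; simp
  | succ k ih =>
  intro t C htp hCI hCt hNC hH
  rcases C.eq_empty_or_nonempty with rfl | hne
  · simp
  obtain ⟨r, hr, hmax⟩ := Finset.exists_max_image
    ((C ∪ C.biUnion (R I M p)).filter (fun r => r.1 < t)) (fun r => r.1) (by
      obtain ⟨q, hq⟩ := hne
      exact ⟨q, by simp [hq, hCt q hq]⟩)
  have hrt : r.1 < t := (Finset.mem_filter.1 hr).2
  have hmaxC : ∀ q ∈ C, q.1 ≤ r.1 := fun q hq => hmax q (by simp [hq, hCt q hq])
  have hmaxR : ∀ q ∈ C, ∀ s ∈ R I M p q, s.1 < t → s.1 ≤ r.1 := fun q hq s hs hst =>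
    hmax s (by
      simp only [Finset.mem_filter, Finset.mem_union, Finset.mem_biUnion]
      exact ⟨Or.inr ⟨q, hq, hs⟩, hst⟩)
  have hrp : r.1 < p.1 := by linarith
  have hxp : ∀ q ∈ C, q.1 < p.1 := fun q hq => by linarith [hCt q hq]
  have hrIM : r ∈ I ∨ ∃ e ∈ M, e.2 = r := by
    simp only [Finset.mem_filter, Finset.mem_union, Finset.mem_biUnion] at hr
    rcases hr.1 with h | ⟨q, -, h⟩
    · exact Or.inl (hCI h)
    · simp only [R, Finset.mem_filter, Finset.mem_union, Finset.mem_image] at h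
      exact h.1
  -- every right endpoint in between, right of r, is r
  have L : ∀ q ∈ C, ∀ q' ∈ C, ∀ f ∈ M, r.1 ≤ f.2.1 → f.2.1 < p.1 →
      Btw (yOn (q, p) f.2.1) (yOn (q', p) f.2.1) f.2.2 → f.2.1 = r.1 := by
    intro q hq q' hq' f hf h1 h2 h3
    by_contra hne'
    obtain ⟨g, hg, hgm⟩ := Finset.exists_max_image
      (M.filter (fun g => r.1 < g.2.1 ∧ g.2.1 < p.1 ∧
        Btw (yOn (q, p) g.2.1) (yOn (q', p) g.2.1) g.2.2)) (fun g => g.2.1)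
      ⟨f, by simp only [Finset.mem_filter]; exact ⟨hf, lt_of_le_of_ne h1 (Ne.symm hne'), h2, h3⟩⟩
    simp only [Finset.mem_filter] at hg hgm
    obtain ⟨hgM, hg1, hg2, hg3⟩ := hg
    have hgt : g.2.1 < t := by
      by_contra hc
      exact hH q hq q' hq' g hgM (not_lt.1 hc) hg2 hg3
    have hgR : g.2 ∈ R I M p q := by
      simp only [R, Finset.mem_filter, Finset.mem_union, Finset.mem_image]
      refine ⟨Or.inr ⟨g, hgM, rfl⟩, lt_of_le_of_lt (hmaxC q hq) hg1, hg2, ?_⟩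
      intro f' hf' ha hb hbt
      have hbt' : Btw (yOn (q, p) g.2.1) (yOn (q', p) g.2.1) (yOn f' g.2.1) := by
        unfold Btw at *
        grind
      have := key (hxp q hq) (hxp q' hq') (hNC q hq) (hNC q' hq') hf' (hM f' hf')
        (x := g.2.1) (by linarith [hmaxC q hq]) (by linarith [hmaxC q' hq']) hg2 ha hb hbt'
      have hle := hgm f' ⟨hf', by linarith, this⟩
      have heq : f' = g := hinj f' hf' g hgM (le_antisymm hle hb)
      subst heq
      have e : yOn f' f'.2.1 = f'.2.2 := yOn_right f'.1 f'.2 (hM _ hf')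
      rw [e] at hbt
      unfold Btw at hbt
      grind
    exact absurd (hmaxR q hq _ hgR hgt) (by linarith)
  -- r is seen by all
  have hsee : ∀ q ∈ C, q ≠ r → r ∈ R I M p q := by
    intro q hq hqr
    have hlt : q.1 < r.1 := by
      refine lt_of_le_of_ne (hmaxC q hq) ?_
      intro h
      rcases hrIM with h' | ⟨e, he, her⟩
      · exact hqr (hI q (hCI hq) r h' h)
      · exact hIM e he q (hCI hq) (by rw [her, h])
    simp only [R, Finset.mem_filter, Finset.mem_union, Finset.mem_image]
    refine ⟨by rcases hrIM with h | ⟨e, he, h⟩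
               · exact Or.inl h
               · exact Or.inr ⟨e, he, h⟩, hlt, hrp, ?_⟩
    intro f hf ha hb hbt
    have hq0 : ∃ q0 ∈ C, ¬ Btw r.2 (yOn (q0, p) r.1) (yOn f r.1) := by
      simp only [Finset.mem_filter, Finset.mem_union, Finset.mem_biUnion] at hr
      rcases hr.1 with h | ⟨q0, hq0, h⟩
      · exact ⟨r, h, by rw [yOn_left]; unfold Btw; grind⟩
      · simp only [R, Finset.mem_filter] at h
        exact ⟨q0, hq0, h.2.2.2 f hf ha hb⟩
    obtain ⟨q0, hq0, hnb⟩ := hq0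
    have hn0 := hNC q0 hq0 f hf r.1 (hmaxC q0 hq0) hrp.le ha hb
    have hbt' : Btw (yOn (q, p) r.1) (yOn (q0, p) r.1) (yOn f r.1) := by
      unfold Btw at *
      grind
    have := key (hxp q hq) (hxp q0 hq0) (hNC q hq) (hNC q0 hq0) hf (hM f hf)
        (x := r.1) (hmaxC q hq) (hmaxC q0 hq0) hrp ha hb hbt'
    have h5 := L q hq q0 hq0 f hf hb this.1 this.2
    have e : yOn f f.2.1 = f.2.2 := yOn_right f.1 f.2 (hM _ hf)
    have hfr : f.2 = r := by
      rcases hrIM with h' | ⟨e, he, her⟩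
      · exact absurd h5 (hIM f hf r h')
      · rw [← her] at h5
        rw [hinj f hf e he h5, her]
    rw [hfr] at e
    rw [e] at hbt
    unfold Btw at hbt
    grind
  have hcard : ∀ q ∈ C, q ≠ r → (k + 1 - ((R I M p q).filter (fun s => s.1 < t)).card) ≤
      k - ((R I M p q).filter (fun s => s.1 < r.1)).card := by
    intro q hq hqr
    have : ((R I M p q).filter (fun s => s.1 < r.1)).card <
        ((R I M p q).filter (fun s => s.1 < t)).card := by
      apply Finset.card_lt_card
      rw [Finset.ssubset_iff_of_subset]
      · exact ⟨r, by simp [hsee q hq hqr, hrt], by simp⟩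
      · intro s hs
        simp only [Finset.mem_filter] at hs ⊢
        exact ⟨hs.1, by linarith [hs.2]⟩
    omega
  have hltr : ∀ q ∈ C, q ≠ r → q.1 < r.1 := by
    intro q hq hqr
    have := hsee q hq hqr
    simp only [R, Finset.mem_filter] at this
    exact this.2.1
  rcases hrIM with hrI | ⟨e, he, her⟩
  · have hih := ih r.1 (C.erase r) hrp.le ((Finset.erase_subset _ _).trans hCI)
      (fun q hq => hltr q (Finset.mem_of_mem_erase hq) (Finset.ne_of_mem_erase hq))
      (fun q hq => hNC q (Finset.mem_of_mem_erase hq))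
      (fun q hq q' hq' f hf h1 h2 h3 => hIM f hf r hrI
        (L q (Finset.mem_of_mem_erase hq) q' (Finset.mem_of_mem_erase hq') f hf h1 h2 h3))
    have h2 : ∑ q ∈ C.erase r, (k + 1 - ((R I M p q).filter (fun s => s.1 < t)).card) ≤ G k :=
      (Finset.sum_le_sum fun q hq =>
        hcard q (Finset.mem_of_mem_erase hq) (Finset.ne_of_mem_erase hq)).trans hih
    have h3 : ∑ q ∈ C, (k + 1 - ((R I M p q).filter (fun s => s.1 < t)).card) ≤
        (k + 1) + ∑ q ∈ C.erase r, (k + 1 - ((R I M p q).filter (fun s => s.1 < t)).card) := by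
      by_cases hrC : r ∈ C
      · rw [← Finset.add_sum_erase _ _ hrC]
        gcongr
        omega
      · rw [Finset.erase_eq_of_notMem hrC]
        omega
    exact (h3.trans (by omega : _ ≤ k + 1 + G k)).trans (le_max_left _ _)
  · have hCr : ∀ q ∈ C, q ≠ r := fun q hq h => hIM e he q (hCI hq) (by rw [her, h])
    have fin : ∀ D ⊆ C, (∀ q ∈ D, ∀ q' ∈ D, ¬ Btw (yOn (q, p) r.1) (yOn (q', p) r.1) r.2) →
        ∑ q ∈ D, (k + 1 - ((R I M p q).filter (fun s => s.1 < t)).card) ≤ G k := by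
      intro D hD hDb
      refine (Finset.sum_le_sum fun q hq => hcard q (hD hq) (hCr q (hD hq))).trans ?_
      refine ih r.1 D hrp.le (hD.trans hCI) (fun q hq => hltr q (hD hq) (hCr q (hD hq)))
        (fun q hq => hNC q (hD hq)) ?_
      intro q hq q' hq' f hf h1 h2 h3
      have h5 := L q (hD hq) q' (hD hq') f hf h1 h2 h3
      rw [← her] at h5
      have := hinj f hf e he h5
      rw [this, her] at h3
      exact hDb q hq q' hq' h3
    rw [← Finset.sum_filter_add_sum_filter_not C (fun q => r.2 < yOn (q, p) r.1)]
    have f1 := fin (C.filter (fun q => r.2 < yOn (q, p) r.1)) (Finset.filter_subset _ _) (by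
      intro q hq q' hq'
      simp only [Finset.mem_filter] at hq hq'
      unfold Btw
      grind)
    have f2 := fin (C.filter (fun q => ¬ r.2 < yOn (q, p) r.1)) (Finset.filter_subset _ _) (by
      intro q hq q' hq'
      simp only [Finset.mem_filter] at hq hq'
      unfold Btw
      grind)
    exact (by omega : _ ≤ 2 * G k).trans (le_max_right _ _)

theorem main' (p : Pt) (I : Finset Pt) (M : Finset (Pt × Pt))
    (hM : ∀ e ∈ M, e.1.1 < e.2.1) (hinj : ∀ e ∈ M, ∀ f ∈ M, e.2.1 = f.2.1 → e = f)
    (hIM : ∀ e ∈ M, ∀ r ∈ I, e.2.1 ≠ r.1) (hI : ∀ r ∈ I, ∀ s ∈ I, r.1 = s.1 → r = s)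
    (C : Finset Pt) (hC : C ⊆ I) (hCp : ∀ q ∈ C, q.1 < p.1) (hNC : ∀ q ∈ C, NC M p q) :
    ∑ q ∈ C, (5 - (R I M p q).card) ≤ 24 := by
  have := main p I M hM hinj hIM hI 5 p.1 C le_rfl hC hCp hNC
    (fun q _ q' _ f _ h1 h2 => absurd h1 (not_le.2 h2))
  have hG : G 5 = 24 := by decide
  rw [hG] at this
  refine le_trans (Finset.sum_le_sum fun q hq => ?_) this
  have := Finset.card_filter_le (R I M p q) (fun r => r.1 < p.1)
  omega

/-! ### translation -/

lemma mem_seg {a b z : Pt} (h : a.1 < b.1) :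
    z ∈ Seg a b ↔ a.1 ≤ z.1 ∧ z.1 ≤ b.1 ∧ z.2 = yOn (a, b) z.1 := by
  have hd : 0 < b.1 - a.1 := by linarith
  constructor
  · rintro ⟨u, v, hu, hv, huv, rfl⟩
    have hu' : u = 1 - v := by linarith
    subst hu'
    simp only [Prod.fst_add, Prod.smul_fst, Prod.snd_add, Prod.smul_snd, smul_eq_mul, yOn]
    refine ⟨by nlinarith, by nlinarith, ?_⟩
    field_simp
    ring
  · rintro ⟨h1, h2, h3⟩
    refine ⟨(b.1 - z.1) / (b.1 - a.1), (z.1 - a.1) / (b.1 - a.1), by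
      apply div_nonneg <;> linarith, by apply div_nonneg <;> linarith, by field_simp; ring, ?_⟩
    apply Prod.ext
    · simp only [Prod.fst_add, Prod.smul_fst, smul_eq_mul]
      field_simp
      ring
    · rw [h3]
      simp only [Prod.snd_add, Prod.smul_snd, smul_eq_mul, yOn]
      field_simp
      ring

lemma open_btw {r z : Pt} {e : Pt × Pt} (h : z ∈ openSegment ℝ r (vproj e r))
    (hne : r.2 ≠ yOn e r.1) : z.1 = r.1 ∧ Btw r.2 (yOn e r.1) z.2 := by
  obtain ⟨u, v, hu, hv, huv, rfl⟩ := h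
  have hu' : u = 1 - v := by linarith
  subst hu'
  simp only [Prod.fst_add, Prod.smul_fst, Prod.snd_add, Prod.smul_snd, smul_eq_mul, vproj]
  refine ⟨by ring, ?_⟩
  unfold Btw
  rcases lt_or_gt_of_ne hne with h | h
  · left; constructor <;> nlinarith
  · right; constructor <;> nlinarith

lemma not_on {P : Finset Pt} (hP : GenPos P) {a b r : Pt} (ha : a ∈ P) (hb : b ∈ P) (hr : r ∈ P)
    (h1 : a.1 < r.1) (h2 : r.1 < b.1) : r.2 ≠ yOn (a, b) r.1 := by
  intro h
  have hs : r ∈ Seg a b := (mem_seg (h1.trans h2)).2 ⟨h1.le, h2.le, h⟩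
  have hw : Wbtw ℝ a r b := mem_segment_iff_wbtw.1 hs
  refine hP.1 a ha r hr b hb ?_ ?_ ?_ hw.collinear
  · rintro rfl; exact lt_irrefl _ h1
  · rintro rfl; exact lt_irrefl _ h2
  · rintro rfl; linarith

/-- Sufficient condition for vertical visibility. -/
lemma vis_of {P : Finset Pt} (hP : GenPos P) {M : Finset (Pt × Pt)} (hM : ∀ e ∈ M, e.1.1 < e.2.1)
    {a b r : Pt} (ha : a ∈ P) (hb : b ∈ P) (hr : r ∈ P)
    (h1 : a.1 < r.1) (h2 : r.1 < b.1)
    (h : ∀ f ∈ M, f.1.1 ≤ r.1 → r.1 ≤ f.2.1 → ¬ Btw r.2 (yOn (a, b) r.1) (yOn f r.1)) :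
    VertVisible P (insert (a, b) M) r (a, b) := by
  have hno := not_on hP ha hb hr h1 h2
  refine ⟨h1, h2, ?_, ?_⟩
  · intro f hf
    ext z
    simp only [Set.mem_inter_iff, Set.mem_empty_iff_false, iff_false, not_and]
    intro hz hz'
    obtain ⟨hz1, hz2⟩ := open_btw hz hno
    rcases Finset.mem_insert.1 hf with rfl | hf
    · have := (mem_seg (h1.trans h2)).1 hz'
      rw [this.2.2, hz1] at hz2
      unfold Btw at hz2
      grind
    · have := (mem_seg (hM f hf)).1 hz'
      rw [this.2.2, hz1] at hz2
      rw [hz1] at this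
      exact h f hf this.1 this.2.1 hz2
  · intro s hs hz
    obtain ⟨hz1, hz2⟩ := open_btw hz hno
    have : s = r := by
      by_contra hc
      exact hP.2 s hs r hr hc hz1
    subst this
    unfold Btw at hz2
    grind

/-- Non-crossing in terms of `yOn`. -/
lemma nc_of {P : Finset Pt} {M : Finset (Pt × Pt)} {a b : Pt}
    (h : IsMatching P (insert (a, b) M)) (hn : (a, b) ∉ M) :
    ∀ f ∈ M, ∀ x, a.1 ≤ x → x ≤ b.1 → f.1.1 ≤ x → x ≤ f.2.1 → yOn f x ≠ yOn (a, b) x := by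
  intro f hf x h1 h2 h3 h4 heq
  have hne : f ≠ (a, b) := by rintro rfl; exact hn hf
  have := h.no_cross f (Finset.mem_insert_of_mem hf) (a, b) (Finset.mem_insert_self _ _) hne
  have hz : ((x, yOn f x) : Pt) ∈ Seg f.1 f.2 ∩ Seg a b :=
    ⟨(mem_seg (h.x_lt f (Finset.mem_insert_of_mem hf))).2 ⟨h3, h4, rfl⟩,
     (mem_seg (h.x_lt (a, b) (Finset.mem_insert_self _ _))).2 ⟨h1, h2, heq⟩⟩
  rw [this] at hz
  exact hz

lemma rank_right {P : Finset Pt} {M : Finset (Pt × Pt)} {p q : Pt} (hp : Isolated M p)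
    (hqp : q.1 < p.1) :
    rank P (insert (q, p) M) p = (P.filter fun r =>
      (Isolated (insert (q, p) M) r ∨ IsRightEndpoint (insert (q, p) M) r) ∧
        VertVisible P (insert (q, p) M) r (q, p)).card := by
  have h1 : ¬ ∃ e ∈ insert (q, p) M, e.1 = p := by
    rintro ⟨e, he, h⟩
    rcases Finset.mem_insert.1 he with rfl | he
    · simp only at h; subst h; exact lt_irrefl _ hqp
    · exact (hp e he).1 h
  have h2 : ∃ e ∈ insert (q, p) M, e.2 = p := ⟨(q, p), Finset.mem_insert_self _ _, rfl⟩
  have h3 : h2.choose = (q, p) := by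
    obtain ⟨he, h⟩ := h2.choose_spec
    rcases Finset.mem_insert.1 he with h' | h'
    · exact h'
    · exact absurd h (hp _ h').2
  unfold rank
  rw [dif_neg h1, dif_pos h2, h3]

lemma rank_left {P : Finset Pt} {M : Finset (Pt × Pt)} {p q : Pt} (hp : Isolated M p) :
    rank P (insert (p, q) M) p = (P.filter fun r =>
      (Isolated (insert (p, q) M) r ∨ IsLeftEndpoint (insert (p, q) M) r) ∧
        VertVisible P (insert (p, q) M) r (p, q)).card := by
  have h2 : ∃ e ∈ insert (p, q) M, e.1 = p := ⟨(p, q), Finset.mem_insert_self _ _, rfl⟩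
  have h3 : h2.choose = (p, q) := by
    obtain ⟨he, h⟩ := h2.choose_spec
    rcases Finset.mem_insert.1 he with h' | h'
    · exact h'
    · exact absurd h (hp _ h').1
  unfold rank
  rw [dif_pos h2, h3]

lemma iso_insert {M : Finset (Pt × Pt)} {a b r : Pt} (h : Isolated M r) (h1 : a.1 < r.1)
    (h2 : r.1 < b.1) : Isolated (insert (a, b) M) r := by
  intro e he
  rcases Finset.mem_insert.1 he with rfl | he
  · constructor
    · rintro rfl; exact lt_irrefl _ h1
    · rintro rfl; exact lt_irrefl _ h2
  · exact h e he

lemma iso_of {P : Finset Pt} {M : Finset (Pt × Pt)} {a b : Pt}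
    (h : IsMatching P (insert (a, b) M)) (hn : (a, b) ∉ M) : Isolated M a ∧ Isolated M b := by
  constructor <;> intro e he <;>
  · have hne : e ≠ (a, b) := by rintro rfl; exact hn he
    have := h.no_shared e (Finset.mem_insert_of_mem he) (a, b) (Finset.mem_insert_self _ _) hne
    simp only at this
    tauto

lemma xinj {P : Finset Pt} (hP : GenPos P) {a b : Pt} (ha : a ∈ P) (hb : b ∈ P)
    (h : a.1 = b.1) : a = b := by
  by_contra hc
  exact hP.2 a ha b hb hc h

lemma left_bound {P : Finset Pt} (hP : GenPos P) {M : Finset (Pt × Pt)} (hM : IsMatching P M)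
    {p : Pt} (hp : p ∈ P) (hpi : Isolated M p) :
    ∑ q ∈ P.filter (fun q => q.1 < p.1 ∧ IsMatching P (insert (q, p) M)),
      (5 - rank P (insert (q, p) M) p) ≤ 24 := by
  have hn : ∀ q, (q, p) ∉ M := fun q h => (hpi _ h).2 rfl
  refine le_trans (Finset.sum_le_sum ?_) (main' p (P.filter (Isolated M)) M hM.x_lt ?_ ?_ ?_ _ ?_ ?_ ?_)
  · intro q hq
    simp only [Finset.mem_filter] at hq
    apply Nat.sub_le_sub_left
    rw [rank_right hpi hq.2.1]
    apply Finset.card_le_card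
    intro r hr
    simp only [R, Finset.mem_filter, Finset.mem_union, Finset.mem_image] at hr ⊢
    obtain ⟨hr1, hv1, hv2, hv3⟩ := hr
    have hrP : r ∈ P := by
      rcases hr1 with h | ⟨e, he, h⟩
      · exact h.1
      · rw [← h]; exact hM.right_mem e he
    refine ⟨hrP, ?_, vis_of hP hM.x_lt hq.1 hp hrP hv1 hv2 hv3⟩
    rcases hr1 with h | ⟨e, he, h⟩
    · exact Or.inl (iso_insert h.2 hv1 hv2)
    · exact Or.inr ⟨e, Finset.mem_insert_of_mem he, h⟩
  · intro e he f hf h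
    by_contra hc
    exact (hM.no_shared e he f hf hc).2.2.2 (xinj hP (hM.right_mem e he) (hM.right_mem f hf) h)
  · intro e he r hr h
    simp only [Finset.mem_filter] at hr
    exact (hr.2 e he).2 (xinj hP (hM.right_mem e he) hr.1 h)
  · intro r hr s hs h
    simp only [Finset.mem_filter] at hr hs
    exact xinj hP hr.1 hs.1 h
  · intro q hq
    simp only [Finset.mem_filter] at hq ⊢
    exact ⟨hq.1, (iso_of hq.2.2 (hn q)).1⟩
  · intro q hq
    simp only [Finset.mem_filter] at hq
    exact hq.2.1
  · intro q hq
    simp only [Finset.mem_filter] at hq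
    exact nc_of hq.2.2 (hn q)

def σ (a : Pt) : Pt := (-a.1, a.2)
def σe (e : Pt × Pt) : Pt × Pt := (σ e.2, σ e.1)

lemma σ_inj : Function.Injective σ := by
  intro a b h
  simp only [σ, Prod.mk.injEq, neg_inj] at h
  exact Prod.ext h.1 h.2

lemma yOn_σ (a b : Pt) (h : a.1 < b.1) (x : ℝ) : yOn (σ b, σ a) x = yOn (a, b) (-x) := by
  have : b.1 - a.1 ≠ 0 := by linarith
  have h2 : -a.1 - -b.1 = b.1 - a.1 := by ring
  simp only [yOn, σ, h2]
  field_simp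
  ring

lemma right_bound {P : Finset Pt} (hP : GenPos P) {M : Finset (Pt × Pt)} (hM : IsMatching P M)
    {p : Pt} (hp : p ∈ P) (hpi : Isolated M p) :
    ∑ q ∈ P.filter (fun q => p.1 < q.1 ∧ IsMatching P (insert (p, q) M)),
      (5 - rank P (insert (p, q) M) p) ≤ 24 := by
  have hn : ∀ q, (p, q) ∉ M := fun q h => (hpi _ h).1 rfl
  have hm := main' (σ p) ((P.filter (Isolated M)).image σ) (M.image σe) ?_ ?_ ?_ ?_
    ((P.filter (fun q => p.1 < q.1 ∧ IsMatching P (insert (p, q) M))).image σ) ?_ ?_ ?_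
  · rw [Finset.sum_image (fun a _ b _ h => σ_inj h)] at hm
    refine le_trans (Finset.sum_le_sum ?_) hm
    intro q hq
    simp only [Finset.mem_filter] at hq
    apply Nat.sub_le_sub_left
    rw [rank_left hpi]
    rw [← Finset.card_image_of_injective (P.filter _) σ_inj]
    apply Finset.card_le_card
    intro r' hr
    simp only [R, Finset.mem_filter, Finset.mem_union, Finset.mem_image] at hr
    obtain ⟨hr1, hv1, hv2, hv3⟩ := hr
    have hr1' : ∃ r, ((r ∈ P ∧ Isolated M r) ∨ ∃ e ∈ M, e.1 = r) ∧ σ r = r' := by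
      rcases hr1 with ⟨r, h, h'⟩ | ⟨e', ⟨e, he, rfl⟩, h⟩
      · exact ⟨r, Or.inl h, h'⟩
      · exact ⟨e.1, Or.inr ⟨e, he, rfl⟩, h⟩
    clear hr1
    obtain ⟨r, hr1, rfl⟩ := hr1'
    have hw1 : r.1 < q.1 := by simp only [σ] at hv1; linarith
    have hw2 : p.1 < r.1 := by simp only [σ] at hv2; linarith
    have hrP : r ∈ P := by
      rcases hr1 with h | ⟨e, he, h⟩
      · exact h.1
      · rw [← h]; exact hM.left_mem e he
    apply Finset.mem_image_of_mem
    simp only [Finset.mem_filter]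
    refine ⟨hrP, ?_, vis_of hP hM.x_lt hp hq.1 hrP hw2 hw1 ?_⟩
    · rcases hr1 with h | ⟨e, he, h⟩
      · exact Or.inl (iso_insert h.2 hw2 hw1)
      · exact Or.inr ⟨e, Finset.mem_insert_of_mem he, h⟩
    · intro f hf h1 h2
      have := hv3 (σe f) (Finset.mem_image_of_mem _ hf) (by simp only [σe, σ]; linarith)
        (by simp only [σe, σ]; linarith)
      rw [yOn_σ p q hq.2.1, σe, yOn_σ f.1 f.2 (hM.x_lt f hf)] at this
      simpa [σ] using this
  · intro e' he'
    obtain ⟨e, he, rfl⟩ := Finset.mem_image.1 he'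
    have := hM.x_lt e he
    simp only [σe, σ]; linarith
  · intro e' he' f' hf' h
    obtain ⟨e, he, rfl⟩ := Finset.mem_image.1 he'
    obtain ⟨f, hf, rfl⟩ := Finset.mem_image.1 hf'
    by_contra hc
    have hc' : e ≠ f := by rintro rfl; exact hc rfl
    simp only [σe, σ, neg_inj] at h
    exact (hM.no_shared e he f hf hc').1 (xinj hP (hM.left_mem e he) (hM.left_mem f hf) h)
  · intro e' he' r' hr' h
    obtain ⟨e, he, rfl⟩ := Finset.mem_image.1 he'
    obtain ⟨r, hr, rfl⟩ := Finset.mem_image.1 hr'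
    simp only [Finset.mem_filter] at hr
    simp only [σe, σ, neg_inj] at h
    exact (hr.2 e he).1 (xinj hP (hM.left_mem e he) hr.1 h)
  · intro r' hr' s' hs' h
    obtain ⟨r, hr, rfl⟩ := Finset.mem_image.1 hr'
    obtain ⟨s, hs, rfl⟩ := Finset.mem_image.1 hs'
    simp only [Finset.mem_filter] at hr hs
    simp only [σ, neg_inj] at h
    rw [xinj hP hr.1 hs.1 h]
  · apply Finset.image_subset_image
    intro q hq
    simp only [Finset.mem_filter] at hq ⊢
    exact ⟨hq.1, (iso_of hq.2.2 (hn q)).2⟩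
  · intro q' hq'
    obtain ⟨q, hq, rfl⟩ := Finset.mem_image.1 hq'
    simp only [Finset.mem_filter] at hq
    simp only [σ]; linarith [hq.2.1]
  · intro q' hq'
    obtain ⟨q, hq, rfl⟩ := Finset.mem_image.1 hq'
    simp only [Finset.mem_filter] at hq
    intro f' hf' x h1 h2 h3 h4
    obtain ⟨f, hf, rfl⟩ := Finset.mem_image.1 hf'
    rw [yOn_σ p q hq.2.1, σe, yOn_σ f.1 f.2 (hM.x_lt f hf)]
    simp only [σe, σ] at h1 h2 h3 h4
    exact nc_of hq.2.2 (hn q) f hf (-x) (by linarith) (by linarith) (by linarith) (by linarith)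

lemma point_bound {P : Finset Pt} (hP : GenPos P) {M : Finset (Pt × Pt)} (hM : IsMatching P M)
    {p : Pt} (hp : p ∈ P) (hpi : Isolated M p) :
    ∑ i ∈ Finset.range (5 + 1), (5 - i) * hcount P M p i ≤ 48 := by
  have h1 : ∑ i ∈ Finset.range (5 + 1), (5 - i) * hcount P M p i ≤
      ∑ q ∈ P.filter (fun q => IsMatching P (addEdge M q p)), (5 - rank P (addEdge M q p) p) := by
    have : ∀ i, (5 - i) * hcount P M p i =
        ∑ q ∈ P.filter (fun q => IsMatching P (addEdge M q p)),
          if rank P (addEdge M q p) p = i then (5 - i) else 0 := by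
      intro i
      rw [hcount, ← Finset.filter_filter, ← Finset.sum_filter, Finset.sum_const, smul_eq_mul,
        mul_comm]
    simp only [this]
    rw [Finset.sum_comm]
    apply Finset.sum_le_sum
    intro q _
    rw [Finset.sum_ite_eq]
    split_ifs <;> simp
  refine h1.trans ?_
  rw [← Finset.sum_filter_add_sum_filter_not _ (fun q => q.1 < p.1)]
  have hl := left_bound hP hM hp hpi
  have hr := right_bound hP hM hp hpi
  have e1 : ∑ q ∈ (P.filter (fun q => IsMatching P (addEdge M q p))).filter (fun q => q.1 < p.1),
      (5 - rank P (addEdge M q p) p) ≤ 24 := by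
    refine le_trans (le_of_eq ?_) hl
    apply Finset.sum_congr
    · ext q
      simp only [Finset.mem_filter]
      constructor
      · rintro ⟨⟨a, b⟩, c⟩
        rw [addEdge, if_pos c] at b
        exact ⟨a, c, b⟩
      · rintro ⟨a, c, b⟩
        rw [addEdge, if_pos c]
        exact ⟨⟨a, b⟩, c⟩
    · intro q hq
      simp only [Finset.mem_filter] at hq
      rw [addEdge, if_pos hq.2.1]
  have e2 : ∑ q ∈ (P.filter (fun q => IsMatching P (addEdge M q p))).filter
      (fun q => ¬ q.1 < p.1), (5 - rank P (addEdge M q p) p) ≤ 24 := by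
    refine le_trans (le_of_eq ?_) hr
    apply Finset.sum_congr
    · ext q
      simp only [Finset.mem_filter]
      constructor
      · rintro ⟨⟨a, b⟩, c⟩
        rw [addEdge, if_neg c] at b
        exact ⟨a, b.x_lt (p, q) (Finset.mem_insert_self _ _), b⟩
      · rintro ⟨a, c, b⟩
        rw [addEdge, if_neg (not_lt.2 c.le)]
        exact ⟨⟨a, b⟩, not_lt.2 c.le⟩
    · intro q hq
      simp only [Finset.mem_filter] at hq
      rw [addEdge, if_neg (not_lt.2 hq.2.1.le)]
  omega

lemma iso_card {P : Finset Pt} {M : Finset (Pt × Pt)} (hM : IsMatching P M) :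
    (P.filter (fun p => Isolated M p)).card + 2 * M.card ≤ P.card := by
  have c1 : (M.image Prod.fst).card = M.card := Finset.card_image_of_injOn (by
    intro e he f hf h
    by_contra hc
    exact (hM.no_shared e he f hf hc).1 h)
  have c2 : (M.image Prod.snd).card = M.card := Finset.card_image_of_injOn (by
    intro e he f hf h
    by_contra hc
    exact (hM.no_shared e he f hf hc).2.2.2 h)
  have d1 : Disjoint (M.image Prod.fst) (M.image Prod.snd) := by
    rw [Finset.disjoint_left]
    intro a ha hb
    obtain ⟨e, he, rfl⟩ := Finset.mem_image.1 ha
    obtain ⟨f, hf, h⟩ := Finset.mem_image.1 hb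
    by_cases hc : e = f
    · subst hc
      have := hM.x_lt e he
      rw [h] at this
      exact lt_irrefl _ this
    · exact (hM.no_shared e he f hf hc).2.1 h.symm
  have d2 : Disjoint (P.filter (fun p => Isolated M p)) (M.image Prod.fst ∪ M.image Prod.snd) := by
    rw [Finset.disjoint_left]
    intro a ha hb
    simp only [Finset.mem_filter] at ha
    rcases Finset.mem_union.1 hb with hb | hb
    · obtain ⟨e, he, h⟩ := Finset.mem_image.1 hb
      exact (ha.2 e he).1 h
    · obtain ⟨e, he, h⟩ := Finset.mem_image.1 hb
      exact (ha.2 e he).2 h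
  have hsub : P.filter (fun p => Isolated M p) ∪ (M.image Prod.fst ∪ M.image Prod.snd) ⊆ P := by
    intro a ha
    rcases Finset.mem_union.1 ha with h | h
    · exact (Finset.mem_filter.1 h).1
    rcases Finset.mem_union.1 h with h | h
    · obtain ⟨e, he, rfl⟩ := Finset.mem_image.1 h
      exact hM.left_mem e he
    · obtain ⟨e, he, rfl⟩ := Finset.mem_image.1 h
      exact hM.right_mem e he
  have := Finset.card_le_card hsub
  rw [Finset.card_union_of_disjoint d2, Finset.card_union_of_disjoint d1, c1, c2] at this
  omega

end Aux

/-- For every integer `m ≥ 1`, writing `s = n − 2m`,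
one has `S_5(m) ≤ 48·(s + 2)·Ma_{m−1}(P)`. -/
theorem Ssum_five_le (P : Finset Pt) (hP : GenPos P) (m : ℕ) (hm : 1 ≤ m) :
    (Ssum P 5 m : ℤ) ≤ 48 * (((P.card : ℤ) - 2 * m) + 2) * Ma P (m - 1) := by
  have key : ∀ M ∈ Matchings P (m - 1),
      ((∑ p ∈ P.filter (fun p => Isolated M p),
        ∑ i ∈ Finset.range (5 + 1), (5 - i) * hcount P M p i : ℕ) : ℤ) ≤
        48 * (((P.card : ℤ) - 2 * m) + 2) := by
    intro M hM
    simp only [Matchings, Finset.mem_filter] at hM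
    obtain ⟨-, hM, hc⟩ := hM
    have h1 : ∑ p ∈ P.filter (fun p => Isolated M p),
        ∑ i ∈ Finset.range (5 + 1), (5 - i) * hcount P M p i ≤
        (P.filter (fun p => Isolated M p)).card * 48 := by
      rw [← smul_eq_mul]
      apply Finset.sum_le_card_nsmul
      intro p hp
      simp only [Finset.mem_filter] at hp
      exact Aux.point_bound hP hM hp.1 hp.2
    have h2 := Aux.iso_card hM
    omega
  unfold Ssum Ma
  rw [Nat.cast_sum]
  refine (Finset.sum_le_card_nsmul _ _ _ key).trans (le_of_eq ?_)
  rw [nsmul_eq_mul]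
  ring
end
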